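/- Every map φ : SLₙ(ℝ) → SLₙ(ℝ), n ≥ 3, such that for every pair A, B ∈ SLₙ(ℝ) there exists an automorphism ψ of the group SLₙ(ℝ) with φ(A) = ψ(A) and φ(B) = ψ(B), is itself a group automorphism of SLₙ(ℝ); moreover there is T ∈ GLₙ(ℝ) with φ(A) = TAT⁻¹ for all A or φ(A) = T(A⁻¹)ᵗT⁻¹ for all A. -/

import Mathlib

open scoped Matrix
/-- sign vector -/
noncomputable def eS {n : ℕ} (i k : Fin n) : ℝ := if k = i then -1 else 1

noncomputable def dS {n : ℕ} (i j : Fin n) : Matrix.SpecialLinearGroup (Fin n) ℝ :=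
  ⟨Matrix.diagonal (fun k => eS i k * eS j k), by
    rw [Matrix.det_diagonal, Finset.prod_mul_distrib]
    simp [eS, Finset.prod_ite_eq']⟩

noncomputable def wS {n : ℕ} (i j : Fin n) (hij : i ≠ j) : Matrix.SpecialLinearGroup (Fin n) ℝ :=
  ⟨Matrix.diagonal (fun k => eS j k) * (Equiv.swap i j).permMatrix ℝ, by
    simp [Matrix.det_diagonal, eS, Finset.prod_ite_eq', Matrix.det_permutation, Equiv.Perm.sign_swap hij]⟩

lemma dS_coe {n : ℕ} (i j : Fin n) :
    (dS i j : Matrix (Fin n) (Fin n) ℝ) = Matrix.diagonal (fun k => eS i k * eS j k) := rfl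

lemma eS_sq {n : ℕ} (i k : Fin n) : eS i k * eS i k = 1 := by
  unfold eS; split_ifs <;> norm_num

lemma dS_mul {n : ℕ} (i j k : Fin n) : dS i j * dS j k = dS i k := by
  apply Subtype.ext
  rw [Matrix.SpecialLinearGroup.coe_mul, dS_coe, dS_coe, dS_coe, Matrix.diagonal_mul_diagonal]
  congr 1; funext l
  linear_combination (eS i l * eS k l) * eS_sq j l

lemma dS_self {n : ℕ} (i : Fin n) : dS i i = 1 := by
  apply Subtype.ext
  rw [dS_coe]; simp [eS_sq]

lemma dS_comm {n : ℕ} (i j : Fin n) : dS i j = dS j i := by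
  apply Subtype.ext
  rw [dS_coe, dS_coe]; simp [mul_comm]

lemma dS_sq {n : ℕ} (i j : Fin n) : dS i j * dS i j = 1 := by
  nth_rewrite 2 [dS_comm]; rw [dS_mul, dS_self]

lemma dS_commute {n : ℕ} (i j k l : Fin n) : dS i j * dS k l = dS k l * dS i j := by
  apply Subtype.ext
  rw [Matrix.SpecialLinearGroup.coe_mul, Matrix.SpecialLinearGroup.coe_mul, dS_coe, dS_coe,
    Matrix.diagonal_mul_diagonal, Matrix.diagonal_mul_diagonal]
  congr 1; funext l; ring

lemma dS_ne_one {n : ℕ} {i j : Fin n} (h : i ≠ j) : dS i j ≠ 1 := by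
  intro H
  have := congrArg (fun A : Matrix.SpecialLinearGroup (Fin n) ℝ => (A : Matrix _ _ ℝ) i i) H
  simp [dS_coe, eS, h] at this
  norm_num at this

lemma wS_apply {n : ℕ} (i j : Fin n) (hij : i ≠ j) (a b : Fin n) :
    (wS i j hij : Matrix (Fin n) (Fin n) ℝ) a b = if b = Equiv.swap i j a then eS j a else 0 := by
  simp [wS, Matrix.diagonal_mul, Equiv.Perm.permMatrix, PEquiv.toMatrix_apply, Equiv.toPEquiv_apply,
    eq_comm]

lemma wS_diag {n : ℕ} (i j : Fin n) (hij : i ≠ j) (s : Fin n → ℝ) :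
    (wS i j hij : Matrix (Fin n) (Fin n) ℝ) * Matrix.diagonal s =
      Matrix.diagonal (fun k => s (Equiv.swap i j k)) * (wS i j hij : Matrix (Fin n) (Fin n) ℝ) := by
  ext a b
  rw [Matrix.mul_diagonal, Matrix.diagonal_mul, wS_apply]
  split_ifs with h
  · rw [h]; ring
  · simp

lemma eS_equiv {n : ℕ} (τ : Equiv.Perm (Fin n)) (i k : Fin n) : eS (τ i) (τ k) = eS i k := by
  simp [eS]

lemma wS_dS {n : ℕ} (i j : Fin n) (hij : i ≠ j) (k l : Fin n) :
    wS i j hij * dS k l = dS (Equiv.swap i j k) (Equiv.swap i j l) * wS i j hij := by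
  apply Subtype.ext
  rw [Matrix.SpecialLinearGroup.coe_mul, Matrix.SpecialLinearGroup.coe_mul, dS_coe, dS_coe, wS_diag]
  congr 2; funext a
  rw [← eS_equiv (Equiv.swap i j) k, ← eS_equiv (Equiv.swap i j) l]
  simp

open Matrix in
lemma common_eig {n : ℕ} {ι : Type*} [DecidableEq ι] (A : ι → Matrix (Fin n) (Fin n) ℝ)
    (hsq : ∀ i, A i * A i = 1) (hcomm : ∀ i j, A i * A j = A j * A i)
    (v : Fin n → ℝ) (hv : v ≠ 0) (s : Finset ι) :
    ∃ w : Fin n → ℝ, w ≠ 0 ∧ (∀ i ∈ s, ∃ c : ℝ, (c = 1 ∨ c = -1) ∧ A i *ᵥ w = c • w) ∧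
      ∀ (B : Matrix (Fin n) (Fin n) ℝ) (c : ℝ), (∀ i, B * A i = A i * B) → B *ᵥ v = c • v →
        B *ᵥ w = c • w := by
  induction s using Finset.induction_on with
  | empty => exact ⟨v, hv, by simp, fun B c _ h => h⟩
  | insert a s ha ih =>
    obtain ⟨w, hw, h1, h2⟩ := ih
    have key : ∀ (e : ℝ), (e = 1 ∨ e = -1) → w + e • (A a *ᵥ w) ≠ 0 →
      ∃ w : Fin n → ℝ, w ≠ 0 ∧ (∀ i ∈ insert a s, ∃ c : ℝ, (c = 1 ∨ c = -1) ∧ A i *ᵥ w = c • w) ∧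
      ∀ (B : Matrix (Fin n) (Fin n) ℝ) (c : ℝ), (∀ i, B * A i = A i * B) → B *ᵥ v = c • v →
        B *ᵥ w = c • w := by
      intro e he hne
      have hB : ∀ (B : Matrix (Fin n) (Fin n) ℝ) (c : ℝ), B * A a = A a * B → B *ᵥ w = c • w →
        B *ᵥ (w + e • (A a *ᵥ w)) = c • (w + e • (A a *ᵥ w)) := by
        intro B c hBA hBw
        rw [mulVec_add, mulVec_smul, mulVec_mulVec, hBA, ← mulVec_mulVec, hBw, mulVec_smul,
          smul_add, smul_comm]
      refine ⟨_, hne, ?_, ?_⟩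
      · intro i hi
        rcases Finset.mem_insert.1 hi with rfl | hi
        · refine ⟨e, he, ?_⟩
          rw [mulVec_add, mulVec_smul, mulVec_mulVec, hsq, one_mulVec, smul_add, smul_smul]
          rcases he with rfl | rfl <;> simp [add_comm]
        · obtain ⟨c, hc, h⟩ := h1 i hi
          exact ⟨c, hc, hB _ _ (hcomm _ _) h⟩
      · intro B c hBA hBv
        exact hB _ _ (hBA a) (h2 B c hBA hBv)
    by_cases h : w + (1:ℝ) • (A a *ᵥ w) = 0
    · refine key (-1) (Or.inr rfl) ?_
      intro h'
      apply hw
      have : (2:ℝ) • w = 0 := by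
        calc (2:ℝ) • w = (w + (1:ℝ) • (A a *ᵥ w)) + (w + (-1:ℝ) • (A a *ᵥ w)) := by module
          _ = 0 := by rw [h, h']; simp
      simpa using this
    · exact key 1 (Or.inl rfl) h

open Matrix in
/-- weight vectors -/
lemma exists_weight {n : ℕ} (o : Fin n)
    (ρ : Matrix.SpecialLinearGroup (Fin n) ℝ →* Matrix (Fin n) (Fin n) ℝ)
    (hρ : Function.Injective ρ) (g : Matrix.SpecialLinearGroup (Fin n) ℝ) (hg : g ≠ 1)
    (hg2 : g * g = 1) (hgd : ∀ i j, g * dS i j = dS i j * g) :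
    ∃ (σ : Fin n → ℝ) (v : Fin n → ℝ), v ≠ 0 ∧ (∀ i, σ i = 1 ∨ σ i = -1) ∧
      (∀ i j, ρ (dS i j) *ᵥ v = (σ i * σ j) • v) ∧ ρ g *ᵥ v = (-1 : ℝ) • v := by
  have h0 : ∃ u : Fin n → ℝ, u - ρ g *ᵥ u ≠ 0 := by
    by_contra! H
    apply hg
    apply hρ
    rw [map_one]
    apply Matrix.toLin'.injective
    apply LinearMap.ext
    intro u
    simpa using (sub_eq_zero.1 (H u)).symm
  obtain ⟨u, hu⟩ := h0
  have hgu : ρ g *ᵥ (u - ρ g *ᵥ u) = (-1:ℝ) • (u - ρ g *ᵥ u) := by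
    rw [mulVec_sub, mulVec_mulVec, ← map_mul, hg2, map_one, one_mulVec]
    module
  obtain ⟨w, hw, h1, h2⟩ := common_eig (fun i : Fin n => ρ (dS o i))
    (fun i => by rw [← map_mul, dS_sq, map_one])
    (fun i j => by rw [← map_mul, ← map_mul, dS_commute]) _ hu Finset.univ
  choose σ hσ1 hσ2 using fun i => h1 i (Finset.mem_univ i)
  refine ⟨σ, w, hw, hσ1, ?_, ?_⟩
  · intro i j
    rw [← dS_mul i o j, map_mul, ← mulVec_mulVec, hσ2 j, mulVec_smul, dS_comm, hσ2 i, smul_smul,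
      mul_comm]
  · exact h2 _ _ (fun i => by rw [← map_mul, ← map_mul, hgd]) hgu

open Matrix in
lemma weight_indep {n : ℕ} {ι : Type*} [DecidableEq ι]
    (ρ : Matrix.SpecialLinearGroup (Fin n) ℝ →* Matrix (Fin n) (Fin n) ℝ)
    (σ : ι → Fin n → ℝ) (v : ι → Fin n → ℝ) (hv : ∀ a, v a ≠ 0)
    (h : ∀ a i j, ρ (dS i j) *ᵥ v a = (σ a i * σ a j) • v a)
    (hne : ∀ a b, a ≠ b → ∃ i j, σ a i * σ a j ≠ σ b i * σ b j) : LinearIndependent ℝ v := by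
  let f : Fin n × Fin n → Module.End ℝ (Fin n → ℝ) := fun p => Matrix.toLin' (ρ (dS p.1 p.2))
  have hind := Module.End.independent_iInf_maxGenEigenspace_of_forall_mapsTo f (by
    intro p q c
    apply Module.End.mapsTo_maxGenEigenspace_of_comm
    show f q * f p = f p * f q
    simp only [f]
    rw [Module.End.mul_eq_comp, Module.End.mul_eq_comp, ← Matrix.toLin'_mul, ← Matrix.toLin'_mul,
      ← map_mul, ← map_mul, dS_commute])
  have hinj : Function.Injective (fun a : ι => fun p : Fin n × Fin n => σ a p.1 * σ a p.2) := by
    intro a b hab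
    by_contra hne'
    obtain ⟨i, j, hij⟩ := hne a b hne'
    exact hij (congrFun hab (i, j))
  refine (hind.comp hinj).linearIndependent _ (fun a => ?_) hv
  simp only [Function.comp, Submodule.mem_iInf]
  intro p
  apply (Module.End.genEigenspace (f p) _).monotone le_top
  · exact Module.End.mem_genEigenspace_one.2 (by simpa [f] using h a p.1 p.2)

open Matrix in
lemma weight_swap {n : ℕ}
    (ρ : Matrix.SpecialLinearGroup (Fin n) ℝ →* Matrix (Fin n) (Fin n) ℝ)
    (σ : Fin n → ℝ) (v : Fin n → ℝ) (hv : v ≠ 0)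
    (h : ∀ i j, ρ (dS i j) *ᵥ v = (σ i * σ j) • v) (i j : Fin n) :
    ∃ w : Fin n → ℝ, w ≠ 0 ∧ ∀ k l, ρ (dS k l) *ᵥ w =
      (σ (Equiv.swap i j k) * σ (Equiv.swap i j l)) • w := by
  by_cases hij : i = j
  · subst hij
    exact ⟨v, hv, by simpa using h⟩
  refine ⟨ρ (wS i j hij) *ᵥ v, ?_, ?_⟩
  · intro H
    apply hv
    have := congrArg (fun u => ρ ((wS i j hij)⁻¹) *ᵥ u) H
    simpa [mulVec_mulVec, ← map_mul] using this
  · intro k l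
    have := wS_dS i j hij (Equiv.swap i j k) (Equiv.swap i j l)
    simp only [Equiv.swap_apply_self] at this
    rw [mulVec_mulVec, ← map_mul, ← this, map_mul, ← mulVec_mulVec, h, mulVec_smul]
open Matrix in
lemma weight_card {n : ℕ} (hn : 5 ≤ n)
    (ρ : Matrix.SpecialLinearGroup (Fin n) ℝ →* Matrix (Fin n) (Fin n) ℝ)
    (σ : Fin n → ℝ) (v : Fin n → ℝ) (hv : v ≠ 0) (hσ : ∀ i, σ i = 1 ∨ σ i = -1)
    (h : ∀ i j, ρ (dS i j) *ᵥ v = (σ i * σ j) • v) :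
    (Finset.univ.filter fun k => σ k = 1).card * (Finset.univ.filter fun k => ¬ σ k = 1).card ≤ n := by
  classical
  set S := Finset.univ.filter fun k => σ k = 1 with hS
  set S' := Finset.univ.filter fun k => ¬ σ k = 1 with hS'
  choose w hw1 hw2 using weight_swap ρ σ v hv h
  have hli : LinearIndependent ℝ (fun a : {p // p ∈ S ×ˢ S'} => w a.1.1 a.1.2) := by
    apply weight_indep ρ (fun a k => σ (Equiv.swap a.1.1 a.1.2 k)) _ (fun a => hw1 _ _)
      (fun a k l => hw2 _ _ k l)
    rintro ⟨⟨i, j⟩, hij⟩ ⟨⟨i', j'⟩, hij'⟩ hne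
    simp only [Finset.mem_product, hS, hS', Finset.mem_filter, Finset.mem_univ, true_and] at hij hij'
    by_contra! H
    simp only at H
    obtain ⟨m, hm⟩ : ∃ m, m ∉ ({i, j, i', j'} : Finset (Fin n)) := by
      by_contra! H'
      have h1 : (Finset.univ : Finset (Fin n)) ⊆ {i, j, i', j'} := fun x _ => H' x
      have h2 := Finset.card_le_card h1
      have h3 := Finset.card_le_four (a := i) (b := j) (c := i') (d := j')
      simp at h2
      omega
    simp only [Finset.mem_insert, Finset.mem_singleton, not_or] at hm
    obtain ⟨m1, m2, m3, m4⟩ := hm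
    have hm0 : σ m ≠ 0 := by rcases hσ m with h | h <;> rw [h] <;> norm_num
    have H2 : ∀ k, σ (Equiv.swap i j k) = σ (Equiv.swap i' j' k) := by
      intro k
      have := H k m
      rw [Equiv.swap_apply_of_ne_of_ne m1 m2, Equiv.swap_apply_of_ne_of_ne m3 m4] at this
      exact mul_right_cancel₀ hm0 this
    have e1 : i = i' := by
      by_contra hc
      have := H2 i
      rw [Equiv.swap_apply_left, Equiv.swap_apply_of_ne_of_ne hc (by rintro rfl; exact hij'.2 hij.1)] at this
      exact hij.2 (this.trans hij.1)
    have e2 : j = j' := by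
      by_contra hc
      have := H2 j
      rw [Equiv.swap_apply_right, Equiv.swap_apply_of_ne_of_ne (by rintro rfl; exact hij.2 hij'.1) hc] at this
      exact hij.2 (this.symm.trans hij.1)
    exact hne (by simp [e1, e2])
  have := hli.fintype_card_le_finrank
  rw [Fintype.card_coe, Finset.card_product] at this
  simpa using this

open Matrix in
lemma exists_min_weight {n : ℕ} (hn : 3 ≤ n)
    (ρ : Matrix.SpecialLinearGroup (Fin n) ℝ →* Matrix (Fin n) (Fin n) ℝ)
    (hρ : Function.Injective ρ) :
    ∃ (i : Fin n) (v : Fin n → ℝ), v ≠ 0 ∧ ∀ k l, ρ (dS k l) *ᵥ v = (eS i k * eS i l) • v := by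
  have hkey : ∃ (σ : Fin n → ℝ) (v : Fin n → ℝ), v ≠ 0 ∧ (∀ i, σ i = 1 ∨ σ i = -1) ∧
      (∀ i j, ρ (dS i j) *ᵥ v = (σ i * σ j) • v) ∧
      ((Finset.univ.filter fun k => σ k = 1).card = 1 ∨
        (Finset.univ.filter fun k => ¬ σ k = 1).card = 1) := by
    by_cases h4 : n = 4
    · subst h4
      obtain ⟨σ, v, hv, hσ, h, hg⟩ := exists_weight 0 ρ hρ (dS 0 1 * dS 2 3) (by
        intro H
        have := congrArg (fun A : Matrix.SpecialLinearGroup (Fin 4) ℝ => (A : Matrix (Fin 4) (Fin 4) ℝ) 0 0) H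
        simp [dS_coe, eS] at this
        norm_num at this) (by
        nth_rewrite 1 [dS_commute 0 1]
        rw [mul_assoc, ← mul_assoc (dS 0 1), dS_sq, one_mul, dS_sq])
        (by
        intro i j
        rw [mul_assoc, dS_commute 2 3, ← mul_assoc, dS_commute 0 1 i j, mul_assoc])
      refine ⟨σ, v, hv, hσ, h, ?_⟩
      rw [map_mul, ← mulVec_mulVec, h, mulVec_smul, h, smul_smul] at hg
      have hg' : σ 2 * σ 3 * (σ 0 * σ 1) = -1 := by
        by_contra hne
        rw [← sub_eq_zero, ← sub_smul] at hg
        rcases smul_eq_zero.1 hg with h | h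
        · exact hne (sub_eq_zero.1 h)
        · exact hv h
      simp only [Finset.card_filter, Fin.sum_univ_four]
      rcases hσ 0 with h0 | h0 <;> rcases hσ 1 with h1 | h1 <;> rcases hσ 2 with h2 | h2 <;>
        rcases hσ 3 with h3 | h3 <;> simp only [h0, h1, h2, h3] at hg' ⊢ <;>
        first | (exfalso; norm_num at hg'; done) | norm_num
    · have h01 : (⟨0, by omega⟩ : Fin n) ≠ ⟨1, by omega⟩ := by simp
      obtain ⟨σ, v, hv, hσ, h, hg⟩ := exists_weight ⟨0, by omega⟩ ρ hρ (dS ⟨0, by omega⟩ ⟨1, by omega⟩)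
        (dS_ne_one h01) (dS_sq _ _) (fun i j => dS_commute _ _ _ _)
      refine ⟨σ, v, hv, hσ, h, ?_⟩
      have hg' : σ ⟨0, by omega⟩ * σ ⟨1, by omega⟩ = -1 := by
        by_contra hne
        rw [h, ← sub_eq_zero, ← sub_smul] at hg
        rcases smul_eq_zero.1 hg with h | h
        · exact hne (sub_eq_zero.1 h)
        · exact hv h
      have hp : 0 < (Finset.univ.filter fun k => σ k = 1).card := by
        rw [Finset.card_pos]
        rcases hσ ⟨0, by omega⟩ with h0 | h0
        · exact ⟨_, by simpa using h0⟩
        · rw [h0] at hg'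
          exact ⟨⟨1, by omega⟩, by simp; linarith⟩
      have hq : 0 < (Finset.univ.filter fun k => ¬ σ k = 1).card := by
        rw [Finset.card_pos]
        by_cases h0 : σ ⟨0, by omega⟩ = 1
        · rw [h0] at hg'
          exact ⟨⟨1, by omega⟩, by simp; intro h; rw [h] at hg'; norm_num at hg'⟩
        · exact ⟨_, by simpa using h0⟩
      have hpq := Finset.card_filter_add_card_filter_not (s := (Finset.univ : Finset (Fin n))) (fun k => σ k = 1)
      rw [Finset.card_univ, Fintype.card_fin] at hpq
      by_cases h3 : n = 3
      · omega
      · have hc := weight_card (by omega) ρ σ v hv hσ h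
        by_contra! H
        set p := (Finset.univ.filter fun k => σ k = 1).card
        set q := (Finset.univ.filter fun k => ¬ σ k = 1).card
        have hp2 : 2 ≤ p := by omega
        have hq2 : 2 ≤ q := by omega
        have : 5 ≤ p + q := by omega
        nlinarith
  obtain ⟨σ, v, hv, hσ, h, hc⟩ := hkey
  rcases hc with hc | hc
  · obtain ⟨i, hi⟩ := Finset.card_eq_one.1 hc
    refine ⟨i, v, hv, fun k l => ?_⟩
    have : ∀ k, σ k = - eS i k := by
      intro k
      have := Finset.ext_iff.1 hi k
      simp at this
      unfold eS
      split_ifs with hk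
      · rw [this.2 hk]; norm_num
      · rcases hσ k with h | h
        · exact absurd (this.1 h) hk
        · exact h
    rw [h, this, this, neg_mul_neg]
  · obtain ⟨i, hi⟩ := Finset.card_eq_one.1 hc
    refine ⟨i, v, hv, fun k l => ?_⟩
    have : ∀ k, σ k = eS i k := by
      intro k
      have := Finset.ext_iff.1 hi k
      simp at this
      unfold eS
      split_ifs with hk
      · rcases hσ k with h | h
        · exact absurd h (this.2 hk)
        · exact h
      · by_contra h
        exact hk (this.1 h)
    rw [h, this, this]

lemma exists_third {n : ℕ} (hn : 3 ≤ n) (a b : Fin n) : ∃ c, c ≠ a ∧ c ≠ b := by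
  by_contra! H
  have h1 : (Finset.univ : Finset (Fin n)) ⊆ {a, b} := fun x _ => by
    have := H x
    simp only [Finset.mem_insert, Finset.mem_singleton]
    tauto
  have h2 := Finset.card_le_card h1
  have h3 := Finset.card_le_two (a := a) (b := b)
  simp at h2
  omega

open Matrix in
lemma exists_basis {n : ℕ} (hn : 3 ≤ n)
    (ρ : Matrix.SpecialLinearGroup (Fin n) ℝ →* Matrix (Fin n) (Fin n) ℝ)
    (hρ : Function.Injective ρ) :
    ∃ T : Matrix (Fin n) (Fin n) ℝ, IsUnit T.det ∧
      ∀ k l, ρ (dS k l) * T = T * (dS k l : Matrix (Fin n) (Fin n) ℝ) := by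
  obtain ⟨i, v, hv, h⟩ := exists_min_weight hn ρ hρ
  have hex : ∀ j, ∃ w : Fin n → ℝ, w ≠ 0 ∧ ∀ k l, ρ (dS k l) *ᵥ w = (eS j k * eS j l) • w := by
    intro j
    obtain ⟨w, hw, hw'⟩ := weight_swap ρ (eS i) v hv h i j
    refine ⟨w, hw, fun k l => ?_⟩
    rw [hw', ← eS_equiv (Equiv.swap i j) j, ← eS_equiv (Equiv.swap i j) j]
    simp
  choose w hw hw' using hex
  have hli : LinearIndependent ℝ w := by
    apply weight_indep ρ eS w hw hw'
    intro a b hab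
    obtain ⟨c, hca, hcb⟩ := exists_third hn a b
    refine ⟨a, c, ?_⟩
    simp [eS, hab, hca, hcb]
    norm_num
  refine ⟨Matrix.of fun a j => w j a, ?_, ?_⟩
  · rw [← Matrix.isUnit_iff_isUnit_det, ← Matrix.linearIndependent_cols_iff_isUnit]
    exact hli
  · intro k l
    ext a j
    rw [dS_coe, mul_diagonal]
    have := congrFun (hw' j k l) a
    simp only [mulVec, dotProduct, Pi.smul_apply, smul_eq_mul] at this
    simp only [mul_apply, of_apply]
    rw [this]
    simp [eS, eq_comm, mul_comm]
/-- entries of `M` outside the diagonal and the `{i,j}` block vanish -/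
def BlockAt {n : ℕ} (i j : Fin n) (M : Matrix (Fin n) (Fin n) ℝ) : Prop :=
  ∀ a b, a ≠ b → M a b ≠ 0 → (a = i ∧ b = j) ∨ (a = j ∧ b = i)

lemma BlockAt.row_i {n : ℕ} {i j : Fin n} {M : Matrix (Fin n) (Fin n) ℝ} (h : BlockAt i j M)
    (hij : i ≠ j) (X : Matrix (Fin n) (Fin n) ℝ) (b : Fin n) :
    (M * X) i b = M i i * X i b + M i j * X j b := by
  rw [Matrix.mul_apply]
  refine Fintype.sum_eq_add i j hij ?_
  rintro x ⟨hx1, hx2⟩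
  have : M i x = 0 := by
    by_contra hc
    rcases h i x (Ne.symm hx1) hc with h | h
    · exact hx2 h.2
    · exact hx1 h.2
  rw [this, zero_mul]

lemma BlockAt.symm {n : ℕ} {i j : Fin n} {M : Matrix (Fin n) (Fin n) ℝ} (h : BlockAt i j M) :
    BlockAt j i M := fun a b hab hM => (h a b hab hM).symm

lemma BlockAt.row_k {n : ℕ} {i j k : Fin n} {M : Matrix (Fin n) (Fin n) ℝ} (h : BlockAt i j M)
    (hki : k ≠ i) (hkj : k ≠ j) (X : Matrix (Fin n) (Fin n) ℝ) (b : Fin n) :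
    (M * X) k b = M k k * X k b := by
  rw [Matrix.mul_apply]
  refine Fintype.sum_eq_single k ?_
  intro x hx
  have : M k x = 0 := by
    by_contra hc
    rcases h k x (Ne.symm hx) hc with h | h
    · exact hki h.1
    · exact hkj h.1
  rw [this, zero_mul]

lemma BlockAt.zero {n : ℕ} {i j a b : Fin n} {M : Matrix (Fin n) (Fin n) ℝ} (h : BlockAt i j M)
    (hab : a ≠ b) (h1 : ¬ (a = i ∧ b = j)) (h2 : ¬ (a = j ∧ b = i)) : M a b = 0 := by
  by_contra hc
  rcases h a b hab hc with h | h
  · exact h1 h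
  · exact h2 h

section stage2

open Matrix

variable {n : ℕ}

lemma commD_entry (ρ : Matrix.SpecialLinearGroup (Fin n) ℝ →* Matrix (Fin n) (Fin n) ℝ)
    (hd : ∀ k l, ρ (dS k l) = (dS k l : Matrix (Fin n) (Fin n) ℝ))
    (g : Matrix.SpecialLinearGroup (Fin n) ℝ) (k l k' l' : Fin n)
    (h : g * dS k l = dS k' l' * g) (a b : Fin n) :
    ρ g a b * (eS k b * eS l b) = eS k' a * eS l' a * ρ g a b := by
  have := congrArg ρ h
  rw [map_mul, map_mul, hd, hd, dS_coe, dS_coe] at this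
  have := congrFun (congrFun this a) b
  rwa [mul_diagonal, diagonal_mul] at this

lemma diag2n_commute_dS {k l : Fin n} (hkl : k ≠ l) (a b : Fin n) :
    SpecialLinearGroup.diag2n hkl (2:ℝ) (by norm_num) * dS a b =
      dS a b * SpecialLinearGroup.diag2n hkl (2:ℝ) (by norm_num) := by
  apply Subtype.ext
  rw [Matrix.SpecialLinearGroup.coe_mul, Matrix.SpecialLinearGroup.coe_mul, dS_coe, SpecialLinearGroup.diag2n_coe,
    diagonal_mul_diagonal, diagonal_mul_diagonal]
  congr 1; funext x; ring

lemma diag2n_wS {k l : Fin n} (hkl : k ≠ l) :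
    SpecialLinearGroup.diag2n hkl (2:ℝ) (by norm_num) * wS k l hkl *
      SpecialLinearGroup.diag2n hkl (2:ℝ) (by norm_num) = wS k l hkl := by
  apply Subtype.ext
  rw [Matrix.SpecialLinearGroup.coe_mul, Matrix.SpecialLinearGroup.coe_mul, SpecialLinearGroup.diag2n_coe,
    Matrix.mul_assoc, wS_diag, ← Matrix.mul_assoc, diagonal_mul_diagonal]
  convert Matrix.one_mul _
  rw [← diagonal_one]
  congr 1; funext x
  by_cases h1 : x = k
  · subst h1; simp [hkl.symm]
  by_cases h2 : x = l
  · subst h2; simp [hkl.symm]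
  · rw [Equiv.swap_apply_of_ne_of_ne h1 h2]; simp [h1, h2]

lemma t_diag
    (hn : 3 ≤ n)
    (ρ : Matrix.SpecialLinearGroup (Fin n) ℝ →* Matrix (Fin n) (Fin n) ℝ)
    (hd : ∀ k l, ρ (dS k l) = (dS k l : Matrix (Fin n) (Fin n) ℝ))
    {k l : Fin n} (hkl : k ≠ l) (a b : Fin n) (hab : a ≠ b) :
    ρ (SpecialLinearGroup.diag2n hkl (2:ℝ) (by norm_num)) a b = 0 := by
  obtain ⟨c, hca, hcb⟩ := exists_third hn a b
  have := commD_entry ρ hd _ a c a c (diag2n_commute_dS hkl a c) a b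
  simp [eS, hab.symm, hca.symm, hcb.symm] at this
  linarith

lemma w_mono
    (hn : 3 ≤ n)
    (ρ : Matrix.SpecialLinearGroup (Fin n) ℝ →* Matrix (Fin n) (Fin n) ℝ)
    (hd : ∀ k l, ρ (dS k l) = (dS k l : Matrix (Fin n) (Fin n) ℝ))
    {k l : Fin n} (hkl : k ≠ l) (a b : Fin n) (hab : b ≠ Equiv.swap k l a) :
    ρ (wS k l hkl) a b = 0 := by
  obtain ⟨c, hca, hcb⟩ := exists_third hn (Equiv.swap k l a) b
  have := commD_entry ρ hd _ b c _ _ (wS_dS k l hkl b c) a b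
  have e1 : eS (Equiv.swap k l b) a = eS b (Equiv.swap k l a) := by
    rw [← eS_equiv (Equiv.swap k l) b]; simp
  have e2 : eS (Equiv.swap k l c) a = eS c (Equiv.swap k l a) := by
    rw [← eS_equiv (Equiv.swap k l) c]; simp
  rw [e1, e2] at this
  simp [eS, hab.symm, hca.symm, hcb.symm] at this
  linarith

lemma t_ne
    (hn : 3 ≤ n)
    (ρ : Matrix.SpecialLinearGroup (Fin n) ℝ →* Matrix (Fin n) (Fin n) ℝ)
    (hρ : Function.Injective ρ)
    (hd : ∀ k l, ρ (dS k l) = (dS k l : Matrix (Fin n) (Fin n) ℝ))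
    {k l : Fin n} (hkl : k ≠ l) :
    ρ (SpecialLinearGroup.diag2n hkl (2:ℝ) (by norm_num)) k k ≠
    ρ (SpecialLinearGroup.diag2n hkl (2:ℝ) (by norm_num)) l l := by
  set t := SpecialLinearGroup.diag2n hkl (2:ℝ) (by norm_num) with ht
  set s : Fin n → ℝ := fun a => ρ t a a with hs
  have hts : ρ t = diagonal s := by
    ext a b
    by_cases hab : a = b
    · subst hab; simp [hs]
    · rw [diagonal_apply_ne _ hab]; exact t_diag hn ρ hd hkl a b hab
  intro heq
  have hw : ∀ a, s a * s (Equiv.swap k l a) = 1 := by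
    intro a
    have h1 := congrArg ρ (diag2n_wS hkl)
    rw [map_mul, map_mul, ← ht, hts] at h1
    have h2 := congrFun (congrFun h1 a) (Equiv.swap k l a)
    rw [mul_diagonal, diagonal_mul] at h2
    have h3 : ρ (wS k l hkl) * ρ ((wS k l hkl)⁻¹) = 1 := by rw [← map_mul]; simp
    have h4 := congrFun (congrFun h3 a) a
    rw [mul_apply, Fintype.sum_eq_single (Equiv.swap k l a) (by
      intro b hb; rw [w_mono hn ρ hd hkl a b hb, zero_mul])] at h4
    have h5 : ρ (wS k l hkl) a (Equiv.swap k l a) ≠ 0 := by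
      intro h; rw [h] at h4; simp at h4
    apply mul_right_cancel₀ h5
    linarith
  have hsq : ∀ a, s a * s a = 1 := by
    intro a
    by_cases h1 : a = k
    · have := hw a
      rw [h1, Equiv.swap_apply_left] at this
      rw [h1]; rw [← this]; congr 1
    by_cases h2 : a = l
    · have := hw a
      rw [h2, Equiv.swap_apply_right] at this
      rw [h2]; rw [← this]; congr 1; exact heq.symm
    · have := hw a
      rwa [Equiv.swap_apply_of_ne_of_ne h1 h2] at this
  have h1 : ρ (t * t) = ρ 1 := by
    rw [map_mul, hts, diagonal_mul_diagonal, map_one, ← diagonal_one]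
    congr 1; funext a; exact hsq a
  have h2 := hρ h1
  have h3 := congrArg (fun A : Matrix.SpecialLinearGroup (Fin n) ℝ => (A : Matrix (Fin n) (Fin n) ℝ) k k) h2
  simp [ht, SpecialLinearGroup.diag2n_coe] at h3
  norm_num at h3

lemma E_commute_diag {i j : Fin n} (hij : i ≠ j) (x : ℝ) (g : SpecialLinearGroup (Fin n) ℝ)
    (s : Fin n → ℝ) (hg : (g : Matrix (Fin n) (Fin n) ℝ) = diagonal s) (hs : s i = s j) :
    SpecialLinearGroup.transvection hij x * g = g * SpecialLinearGroup.transvection hij x := by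
  apply Subtype.ext
  rw [Matrix.SpecialLinearGroup.coe_mul, Matrix.SpecialLinearGroup.coe_mul, hg, SpecialLinearGroup.transvection_coe]
  ext a b
  rw [mul_diagonal, diagonal_mul]
  simp only [Matrix.add_apply, one_apply, single_apply]
  split_ifs with h1 h2 h2
  · subst h1; ring
  · subst h1; ring
  · rw [← h2.1, ← h2.2, hs]; ring
  · ring

lemma E_block
    (hn : 3 ≤ n)
    (ρ : Matrix.SpecialLinearGroup (Fin n) ℝ →* Matrix (Fin n) (Fin n) ℝ)
    (hρ : Function.Injective ρ)
    (hd : ∀ k l, ρ (dS k l) = (dS k l : Matrix (Fin n) (Fin n) ℝ))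
    {i j : Fin n} (hij : i ≠ j) (x : ℝ) :
    BlockAt i j (ρ (SpecialLinearGroup.transvection hij x)) := by
  intro a b hab
  contrapose!
  rintro ⟨h1, h2⟩
  have hone : ((a = i ∨ a = j) ∧ (b ≠ i ∧ b ≠ j)) ∨ ((b = i ∨ b = j) ∧ (a ≠ i ∧ a ≠ j)) ∨
      ((a ≠ i ∧ a ≠ j) ∧ (b ≠ i ∧ b ≠ j)) := by
    by_cases ha : a = i <;> by_cases hb : b = i <;> by_cases ha' : a = j <;> by_cases hb' : b = j <;>
      simp_all
  have hcomm := commD_entry ρ hd _ i j i j (E_commute_diag hij x (dS i j) _ (dS_coe i j)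
    (by simp [eS, hij, hij.symm])) a b
  rcases hone with ⟨h3, h4, h5⟩ | ⟨h3, h4, h5⟩ | ⟨⟨h3, h4⟩, h5, h6⟩
  · have : eS i a * eS j a = -1 := by
      rcases h3 with rfl | rfl <;> simp [eS, hij, hij.symm]
    rw [this] at hcomm
    simp [eS, h4, h5] at hcomm
    linarith
  · have : eS i b * eS j b = -1 := by
      rcases h3 with rfl | rfl <;> simp [eS, hij, hij.symm]
    rw [this] at hcomm
    simp [eS, h4, h5] at hcomm
    linarith
  · have h := congrArg ρ (E_commute_diag hij x (SpecialLinearGroup.diag2n hab (2:ℝ) (by norm_num)) _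
      (SpecialLinearGroup.diag2n_coe hab _ _) (by simp [h3.symm, h4.symm, h5.symm, h6.symm]))
    rw [map_mul, map_mul] at h
    have h' := congrFun (congrFun h a) b
    have htd := t_diag hn ρ hd hab
    rw [mul_apply, mul_apply, Fintype.sum_eq_single b (by
      intro c hc; rw [htd c b hc, mul_zero]), Fintype.sum_eq_single a (by
      intro c hc; rw [htd a c (Ne.symm hc), zero_mul])] at h'
    have hne := t_ne hn ρ hρ hd hab
    by_contra hc
    apply hne
    apply mul_right_cancel₀ hc
    linarith

lemma E_inv_d {i j c : Fin n} (hij : i ≠ j) (hci : c ≠ i) (hcj : c ≠ j) (x : ℝ) :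
    SpecialLinearGroup.transvection hij x * dS i c * SpecialLinearGroup.transvection hij x = dS i c := by
  have : SpecialLinearGroup.transvection hij x * dS i c = dS i c * SpecialLinearGroup.transvection hij (-x) := by
    apply Subtype.ext
    rw [Matrix.SpecialLinearGroup.coe_mul, Matrix.SpecialLinearGroup.coe_mul, dS_coe,
      SpecialLinearGroup.transvection_coe, SpecialLinearGroup.transvection_coe]
    ext a b
    rw [mul_diagonal, diagonal_mul]
    simp only [Matrix.add_apply, one_apply, single_apply]
    split_ifs with h1 h2 h2
    · subst h1; exact absurd (h2.1.trans h2.2.symm) hij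
    · subst h1; ring
    · rw [← h2.1, ← h2.2]; simp [eS, hij.symm, hci.symm, hcj.symm]
    · ring
  rw [this, mul_assoc, ← SpecialLinearGroup.transvection_add]
  simp

/-- quadratic relations for the image of a transvection -/
lemma E_rel
    (hn : 3 ≤ n)
    (ρ : Matrix.SpecialLinearGroup (Fin n) ℝ →* Matrix (Fin n) (Fin n) ℝ)
    (hρ : Function.Injective ρ)
    (hd : ∀ k l, ρ (dS k l) = (dS k l : Matrix (Fin n) (Fin n) ℝ))
    {i j : Fin n} (hij : i ≠ j) (x : ℝ) :
    let M := ρ (SpecialLinearGroup.transvection hij x)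
    (∀ k, k ≠ i → k ≠ j → M k k * M k k = 1) ∧ M i i * M i i - M i j * M j i = 1 ∧
    M j j * M j j - M i j * M j i = 1 ∧ M i j * (M j j - M i i) = 0 ∧ M j i * (M j j - M i i) = 0 := by
  intro M
  have hB : BlockAt i j M := E_block hn ρ hρ hd hij x
  obtain ⟨c, hci, hcj⟩ := exists_third hn i j
  have h := congrArg ρ (E_inv_d hij hci hcj x)
  rw [map_mul, map_mul, hd, dS_coe, Matrix.mul_assoc] at h
  have hh : ∀ a b, (M * (diagonal (fun k => eS i k * eS c k) * M)) a b =
      (diagonal (fun k => eS i k * eS c k) : Matrix (Fin n) (Fin n) ℝ) a b :=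
    fun a b => congrFun (congrFun h a) b
  have hsi : eS i i * eS c i = -1 := by simp [eS, hci.symm]
  have hsj : eS i j * eS c j = 1 := by simp [eS, hcj.symm, hij.symm]
  refine ⟨?_, ?_, ?_, ?_, ?_⟩
  · intro k hki hkj
    have := hh k k
    rw [hB.row_k hki hkj, diagonal_mul, diagonal_apply_eq] at this
    have h0 : eS i k * eS c k ≠ 0 := by
      unfold eS; split_ifs <;> norm_num
    apply mul_left_cancel₀ h0
    linarith
  · have := hh i i
    rw [hB.row_i hij, diagonal_mul, diagonal_apply_eq, diagonal_mul, hsi, hsj] at this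
    linarith
  · have := hh j j
    rw [hB.symm.row_i hij.symm, diagonal_mul, diagonal_apply_eq, diagonal_mul, hsi, hsj] at this
    linarith
  · have := hh i j
    rw [hB.row_i hij, diagonal_mul, diagonal_apply_ne _ hij, diagonal_mul, hsi, hsj] at this
    linarith
  · have := hh j i
    rw [hB.symm.row_i hij.symm, diagonal_mul, diagonal_apply_ne _ hij.symm, diagonal_mul, hsi, hsj] at this
    linarith

lemma transvection_ne_one {i j : Fin n} (hij : i ≠ j) {x : ℝ} (hx : x ≠ 0) :
    SpecialLinearGroup.transvection hij x ≠ 1 := by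
  intro H
  have := congrArg (fun A : Matrix.SpecialLinearGroup (Fin n) ℝ => (A : Matrix (Fin n) (Fin n) ℝ) i j) H
  simp [SpecialLinearGroup.transvection_coe, hij] at this
  exact hx this

lemma E_facts
    (hn : 3 ≤ n)
    (ρ : Matrix.SpecialLinearGroup (Fin n) ℝ →* Matrix (Fin n) (Fin n) ℝ)
    (hρ : Function.Injective ρ)
    (hd : ∀ k l, ρ (dS k l) = (dS k l : Matrix (Fin n) (Fin n) ℝ))
    {i j : Fin n} (hij : i ≠ j) {x : ℝ} (hx : x ≠ 0) :
    let M := ρ (SpecialLinearGroup.transvection hij x)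
    (∀ k, k ≠ i → k ≠ j → M k k = 1) ∧ M i i = M j j ∧ (M i j ≠ 0 ∨ M j i ≠ 0) := by
  intro M
  obtain ⟨r1, r2, r3, r4, r5⟩ := E_rel hn ρ hρ hd hij x
  have hB : BlockAt i j M := E_block hn ρ hρ hd hij x
  have hne : M i j ≠ 0 ∨ M j i ≠ 0 := by
    by_contra! H
    have hM : M = diagonal (fun a => M a a) := by
      ext a b
      by_cases hab : a = b
      · subst hab; simp
      · rw [diagonal_apply_ne _ hab]
        by_contra hc
        rcases hB a b hab hc with ⟨rfl, rfl⟩ | ⟨rfl, rfl⟩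
        · exact hc H.1
        · exact hc H.2
    have h2 : ρ (SpecialLinearGroup.transvection hij (x + x)) = ρ 1 := by
      rw [SpecialLinearGroup.transvection_add, map_mul, map_one]
      show M * M = 1
      rw [hM, diagonal_mul_diagonal, ← diagonal_one]
      congr 1; funext a
      by_cases h1 : a = i
      · subst h1; have := r2; change M a a * M a a - M a j * M j a = 1 at this
        rw [H.1] at this; linarith
      by_cases h2 : a = j
      · subst h2; have := r3; change M a a * M a a - M i a * M a i = 1 at this
        rw [H.1] at this; linarith
      · exact r1 a h1 h2
    exact transvection_ne_one hij (by simpa using hx) (hρ h2)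
  refine ⟨?_, ?_, hne⟩
  · intro k hki hkj
    set N := ρ (SpecialLinearGroup.transvection hij (x/2)) with hN
    have hMN : M = N * N := by
      rw [hN, ← map_mul, ← SpecialLinearGroup.transvection_add, add_halves]
    rw [hMN, (E_block hn ρ hρ hd hij (x/2)).row_k hki hkj]
    exact (E_rel hn ρ hρ hd hij (x/2)).1 k hki hkj
  · rcases hne with h | h
    · have := (mul_eq_zero.1 r4).resolve_left h
      exact (sub_eq_zero.1 this).symm
    · have := (mul_eq_zero.1 r5).resolve_left h
      exact (sub_eq_zero.1 this).symm

lemma E_row_comm {i j k : Fin n} (hij : i ≠ j) (hik : i ≠ k) (x y : ℝ) :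
    SpecialLinearGroup.transvection hij x * SpecialLinearGroup.transvection hik y =
    SpecialLinearGroup.transvection hik y * SpecialLinearGroup.transvection hij x := by
  apply Subtype.ext
  simp [SpecialLinearGroup.transvection_coe, mul_add, add_mul,
    single_mul_single_of_ne _ _ _ _ hij.symm, single_mul_single_of_ne _ _ _ _ hik.symm]
  abel

lemma E_col_comm {i j k : Fin n} (hij : i ≠ j) (hkj : k ≠ j) (x y : ℝ) :
    SpecialLinearGroup.transvection hij x * SpecialLinearGroup.transvection hkj y =
    SpecialLinearGroup.transvection hkj y * SpecialLinearGroup.transvection hij x := by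
  apply Subtype.ext
  simp [SpecialLinearGroup.transvection_coe, mul_add, add_mul,
    single_mul_single_of_ne _ _ _ _ hij.symm, single_mul_single_of_ne _ _ _ _ hkj.symm]
  abel

lemma E_row
    (hn : 3 ≤ n)
    (ρ : Matrix.SpecialLinearGroup (Fin n) ℝ →* Matrix (Fin n) (Fin n) ℝ)
    (hρ : Function.Injective ρ)
    (hd : ∀ k l, ρ (dS k l) = (dS k l : Matrix (Fin n) (Fin n) ℝ))
    {i j k : Fin n} (hij : i ≠ j) (hik : i ≠ k) (hjk : j ≠ k) {x y : ℝ} (hx : x ≠ 0)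
    (hy : y ≠ 0) :
    let M := ρ (SpecialLinearGroup.transvection hij x)
    let M' := ρ (SpecialLinearGroup.transvection hik y)
    M' i i = 1 ∧ M j i * M' i k = 0 ∧ M i j * M' k i = 0 := by
  intro M M'
  have hB : BlockAt i j M := E_block hn ρ hρ hd hij x
  have hB' : BlockAt i k M' := E_block hn ρ hρ hd hik y
  obtain ⟨f1, f2, f3⟩ : (∀ k, k ≠ i → k ≠ j → M k k = 1) ∧ M i i = M j j ∧ (M i j ≠ 0 ∨ M j i ≠ 0) :=
    E_facts hn ρ hρ hd hij hx
  obtain ⟨g1, g2, g3⟩ : (∀ l, l ≠ i → l ≠ k → M' l l = 1) ∧ M' i i = M' k k ∧ (M' i k ≠ 0 ∨ M' k i ≠ 0) :=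
    E_facts hn ρ hρ hd hik hy
  have hc : M * M' = M' * M := by
    have := congrArg ρ (E_row_comm hij hik x y)
    rwa [map_mul, map_mul] at this
  have hh : ∀ a b, (M * M') a b = (M' * M) a b := fun a b => by rw [hc]
  have z1 : M' i j = 0 := hB'.zero hij (by simp [hjk]) (by simp [hik])
  have z2 : M' j i = 0 := hB'.zero hij.symm (by simp [hij.symm]) (by simp [hjk])
  have z3 : M' j k = 0 := hB'.zero hjk (by simp [hij.symm]) (by simp [hjk])
  have z4 : M' k j = 0 := hB'.zero hjk.symm (by simp [hik.symm]) (by simp [hij.symm])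
  have y1 : M i k = 0 := hB.zero hik (by simp [hjk.symm]) (by simp [hij])
  have y2 : M k i = 0 := hB.zero hik.symm (by simp [hik.symm]) (by simp [hjk.symm])
  have y3 : M j k = 0 := hB.zero hjk (by simp [hij.symm]) (by simp [hik.symm])
  have y4 : M k j = 0 := hB.zero hjk.symm (by simp [hik.symm]) (by simp [hjk.symm])
  have w1 := g1 j hij.symm hjk
  refine ⟨?_, ?_, ?_⟩
  · rcases f3 with h | h
    · have := hh i j
      rw [hB.row_i hij, hB'.row_i hik, z1, w1, y4] at this
      apply mul_right_cancel₀ h; linarith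
    · have := hh j i
      rw [hB.symm.row_i hij.symm, hB'.row_k hij.symm hjk, z2, w1] at this
      apply mul_right_cancel₀ h; linarith
  · have := hh j k
    rw [hB.symm.row_i hij.symm, hB'.row_k hij.symm hjk, z3, y3] at this
    linarith
  · have := hh k j
    rw [hB.row_k hik.symm hjk.symm, hB'.symm.row_i hik.symm, z4, y4] at this
    linarith

lemma E_diag_one
    (hn : 3 ≤ n)
    (ρ : Matrix.SpecialLinearGroup (Fin n) ℝ →* Matrix (Fin n) (Fin n) ℝ)
    (hρ : Function.Injective ρ)
    (hd : ∀ k l, ρ (dS k l) = (dS k l : Matrix (Fin n) (Fin n) ℝ))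
    {i j : Fin n} (hij : i ≠ j) {x : ℝ} (hx : x ≠ 0) :
    let M := ρ (SpecialLinearGroup.transvection hij x)
    (∀ k, M k k = 1) ∧ M i j * M j i = 0 := by
  intro M
  obtain ⟨k, hki, hkj⟩ := exists_third hn i j
  have h1 : M i i = 1 := (E_row hn ρ hρ hd hki.symm hij hkj one_ne_zero hx).1
  obtain ⟨f1, f2, f3⟩ : (∀ k, k ≠ i → k ≠ j → M k k = 1) ∧ M i i = M j j ∧ (M i j ≠ 0 ∨ M j i ≠ 0) :=
    E_facts hn ρ hρ hd hij hx
  obtain ⟨r1, r2, r3, r4, r5⟩ := E_rel hn ρ hρ hd hij x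
  constructor
  · intro k
    by_cases h : k = i
    · rw [h, h1]
    by_cases h' : k = j
    · rw [h', ← f2, h1]
    exact f1 k h h'
  · change M i i * M i i - M i j * M j i = 1 at r2
    rw [h1] at r2; linarith

/-- either all `M j i` vanish or all `M i j` vanish -/
lemma E_type
    (hn : 3 ≤ n)
    (ρ : Matrix.SpecialLinearGroup (Fin n) ℝ →* Matrix (Fin n) (Fin n) ℝ)
    (hρ : Function.Injective ρ)
    (hd : ∀ k l, ρ (dS k l) = (dS k l : Matrix (Fin n) (Fin n) ℝ))
    : (∀ i j (hij : i ≠ j) (x : ℝ), ρ (SpecialLinearGroup.transvection hij x) j i = 0) ∨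
    (∀ i j (hij : i ≠ j) (x : ℝ), ρ (SpecialLinearGroup.transvection hij x) i j = 0) := by
  by_cases hall : ∀ i j (hij : i ≠ j) (x : ℝ), ρ (SpecialLinearGroup.transvection hij x) j i = 0
  · exact Or.inl hall
  right
  push Not at hall
  obtain ⟨i, j, hij, x, hx⟩ := hall
  have hx0 : x ≠ 0 := by
    rintro rfl
    rw [SpecialLinearGroup.transvection_coeff_zero, map_one, one_apply_ne hij.symm] at hx
    exact hx rfl
  let Q : ∀ i j : Fin n, i ≠ j → Prop := fun i j hij =>
    ∀ y : ℝ, y ≠ 0 → ρ (SpecialLinearGroup.transvection hij y) j i ≠ 0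
  have row : ∀ (i j k : Fin n) (hij : i ≠ j) (hik : i ≠ k) (hjk : j ≠ k) (x : ℝ), x ≠ 0 →
      ρ (SpecialLinearGroup.transvection hij x) j i ≠ 0 → Q i k hik := by
    intro i j k hij hik hjk x hx0 hx y hy
    have h1 := (E_row hn ρ hρ hd hij hik hjk hx0 hy).2.1
    have h2 := (mul_eq_zero.1 h1).resolve_left hx
    exact (E_facts hn ρ hρ hd hik hy).2.2.resolve_left (fun h => h h2)
  have row' : ∀ (i j k : Fin n) (hij : i ≠ j) (hik : i ≠ k), j ≠ k → Q i j hij → Q i k hik :=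
    fun i j k hij hik hjk h => row i j k hij hik hjk 1 one_ne_zero (h 1 one_ne_zero)
  have col : ∀ (i j k : Fin n) (hij : i ≠ j) (hkj : k ≠ j), Q i j hij → Q k j hkj := by
    intro i j k hij hkj hQ y hy hc
    by_cases hik : i = k
    · subst hik; exact hQ y hy hc
    have h1 := hQ 1 one_ne_zero
    have h2 := (E_facts hn ρ hρ hd hkj hy).2.2.resolve_right (fun h => h hc)
    have h3 := (mul_eq_zero.1 (E_diag_one hn ρ hρ hd hij one_ne_zero).2).resolve_right h1
    have hB := E_block hn ρ hρ hd hij 1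
    have hB' := E_block hn ρ hρ hd hkj y
    have h4 := congrArg ρ (E_col_comm hij hkj 1 y)
    rw [map_mul, map_mul] at h4
    have h5 := congrFun (congrFun h4 k) i
    rw [hB.row_k (Ne.symm hik) hkj, hB'.row_i hkj, hB.zero (Ne.symm hik) (by simp [hij]) (by simp [hkj]),
      hB'.zero (Ne.symm hik) (by simp [hij]) (by simp [hkj])] at h5
    have : ρ (SpecialLinearGroup.transvection hkj y) k j * ρ (SpecialLinearGroup.transvection hij 1) j i = 0 := by
      linarith
    exact (mul_ne_zero h2 h1) this
  have Qi : ∀ l (hil : i ≠ l), Q i l hil := by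
    obtain ⟨m, hmi, hmj⟩ := exists_third hn i j
    have hm := row i j m hij hmi.symm hmj.symm x hx0 hx
    intro l hil
    by_cases hl : l = m
    · subst hl; exact hm
    · exact row' i m l hmi.symm hil (Ne.symm hl) hm
  have Qall : ∀ k l (hkl : k ≠ l), Q k l hkl := by
    intro k l hkl
    by_cases hl : i = l
    · subst hl
      obtain ⟨m, hmk, hmi⟩ := exists_third hn k i
      exact row' k m i hmk.symm hkl hmi (col i m k hmi.symm hmk.symm (Qi m hmi.symm))
    · exact col i l k hl hkl (Qi l hl)
  intro k l hkl y
  by_cases hy : y = 0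
  · subst hy
    rw [SpecialLinearGroup.transvection_coeff_zero, map_one, one_apply_ne hkl]
  exact (mul_eq_zero.1 (E_diag_one hn ρ hρ hd hkl hy).2).resolve_right (Qall k l hkl y hy)

lemma E_eq
    (hn : 3 ≤ n)
    (ρ : Matrix.SpecialLinearGroup (Fin n) ℝ →* Matrix (Fin n) (Fin n) ℝ)
    (hρ : Function.Injective ρ)
    (hd : ∀ k l, ρ (dS k l) = (dS k l : Matrix (Fin n) (Fin n) ℝ))
    (ht : ∀ i j (hij : i ≠ j) (x : ℝ), ρ (SpecialLinearGroup.transvection hij x) j i = 0)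
    {i j : Fin n} (hij : i ≠ j) (x : ℝ) :
    ρ (SpecialLinearGroup.transvection hij x) =
      1 + single i j (ρ (SpecialLinearGroup.transvection hij x) i j) := by
  by_cases hx : x = 0
  · subst hx
    simp [one_apply_ne hij]
  ext a b
  by_cases hab : a = b
  · subst hab
    rw [(E_diag_one hn ρ hρ hd hij hx).1 a]
    simp only [Matrix.add_apply, one_apply_eq, single_apply]
    rw [if_neg]; · simp
    rintro ⟨rfl, rfl⟩; exact hij rfl
  · simp only [Matrix.add_apply, one_apply_ne hab, single_apply, zero_add]
    split_ifs with h
    · rw [← h.1, ← h.2]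
    · by_contra hc
      rcases E_block hn ρ hρ hd hij x a b hab hc with h' | h'
      · exact h ⟨h'.1.symm, h'.2.symm⟩
      · rw [h'.1, h'.2] at hc; exact hc (ht _ _ hij x)

end stage2
section stage3

open Matrix

lemma E_rel_mul {n : ℕ} {i j k : Fin n} (hij : i ≠ j) (hjk : j ≠ k) (hik : i ≠ k) (x y : ℝ) :
    SpecialLinearGroup.transvection hij x * SpecialLinearGroup.transvection hjk y =
      SpecialLinearGroup.transvection hik (x * y) * SpecialLinearGroup.transvection hjk y *
        SpecialLinearGroup.transvection hij x := by
  apply Subtype.ext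
  simp [SpecialLinearGroup.transvection_coe, mul_add, add_mul,
    single_mul_single_of_ne _ _ _ _ hij.symm, single_mul_single_of_ne _ _ _ _ hik.symm,
    single_mul_single_of_ne _ _ _ _ hjk.symm]
  abel

lemma diag2n_decomp {n : ℕ} {i j : Fin n} (hij : i ≠ j) (a : ℝ) (ha : a ≠ 0) :
    SpecialLinearGroup.diag2n hij a ha = SpecialLinearGroup.transvection hij a *
      SpecialLinearGroup.transvection hij.symm (- a⁻¹) *
      SpecialLinearGroup.transvection hij a *
      SpecialLinearGroup.transvection hij (-1) *
      SpecialLinearGroup.transvection hij.symm 1 *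
      SpecialLinearGroup.transvection hij (-1) := by
  apply Subtype.ext
  have e : ∀ (p q r s : Fin n) (x y : ℝ), single p q x * single r s y =
      if q = r then single p s (x * y) else 0 := by
    intro p q r s x y
    split_ifs with h
    · subst h; simp
    · exact single_mul_single_of_ne _ _ _ _ h _
  have hd : (SpecialLinearGroup.diag2n hij a ha : Matrix (Fin n) (Fin n) ℝ) =
      1 + single i i (a - 1) + single j j (a⁻¹ - 1) := by
    rw [SpecialLinearGroup.diag2n_coe]
    ext k l
    simp only [Matrix.add_apply, one_apply, single_apply, diagonal_apply]
    by_cases hkl : k = l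
    · subst hkl
      by_cases h1 : k = i
      · subst h1; simp [hij.symm]
      · by_cases h2 : k = j
        · subst h2; simp [h1, hij]
        · simp [h1, h2, Ne.symm h1, Ne.symm h2]
    · have h1 : ¬ (i = k ∧ i = l) := by rintro ⟨rfl, rfl⟩; exact hkl rfl
      have h2 : ¬ (j = k ∧ j = l) := by rintro ⟨rfl, rfl⟩; exact hkl rfl
      simp [hkl, h1, h2]
  simp only [Matrix.SpecialLinearGroup.coe_mul]
  rw [hd]
  simp only [SpecialLinearGroup.transvection_coe, mul_add, add_mul, e, hij, hij.symm, if_true, if_false,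
    mul_one, one_mul, Matrix.mul_zero, Matrix.zero_mul, add_zero]
  ext k l
  simp only [Matrix.add_apply, one_apply, single_apply]
  split_ifs <;> field_simp <;> ring

lemma SL_induction {n : ℕ} (hn : 3 ≤ n) (P : Matrix.SpecialLinearGroup (Fin n) ℝ → Prop)
    (h1 : ∀ i j (hij : i ≠ j) x, P (SpecialLinearGroup.transvection hij x))
    (h2 : ∀ A B, P A → P B → P (A * B)) (A) : P A := by
  haveI : Nontrivial (Fin n) := ⟨⟨0, by omega⟩, ⟨1, by omega⟩, by simp⟩
  refine SpecialLinearGroup.diagonal_transvection_induction' P A ?_ h1 h2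
  intro i j hij c hc
  rw [diag2n_decomp]
  exact h2 _ _ (h2 _ _ (h2 _ _ (h2 _ _ (h2 _ _ (h1 _ _ _ _) (h1 _ _ _ _)) (h1 _ _ _ _)) (h1 _ _ _ _))
    (h1 _ _ _ _)) (h1 _ _ _ _)

lemma plus_type {n : ℕ} (hn : 3 ≤ n)
    (ρ : Matrix.SpecialLinearGroup (Fin n) ℝ →* Matrix (Fin n) (Fin n) ℝ)
    (hρ : Function.Injective ρ)
    (hd : ∀ k l, ρ (dS k l) = (dS k l : Matrix (Fin n) (Fin n) ℝ))
    (ht : ∀ i j (hij : i ≠ j) (x : ℝ), ρ (SpecialLinearGroup.transvection hij x) j i = 0) :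
    ∃ S : Matrix (Fin n) (Fin n) ℝ, IsUnit S.det ∧
      ∀ A, ρ A * S = S * (A : Matrix (Fin n) (Fin n) ℝ) := by
  have hex : ∀ i j : Fin n, ∃ f : ℝ → ℝ, ∀ (hij : i ≠ j) x,
      ρ (SpecialLinearGroup.transvection hij x) = 1 + single i j (f x) := by
    intro i j
    by_cases hij : i = j
    · exact ⟨id, fun h => absurd hij h⟩
    · exact ⟨_, fun _ x => E_eq hn ρ hρ hd ht hij x⟩
  choose f hf using hex
  have hadd : ∀ i j, i ≠ j → ∀ x y, f i j (x + y) = f i j x + f i j y := by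
    intro i j hij x y
    have := congrArg ρ (SpecialLinearGroup.transvection_add hij x y)
    rw [map_mul, hf, hf, hf] at this
    have := congrFun (congrFun this i) j
    simpa [mul_add, add_mul, single_mul_single_of_ne _ _ _ _ hij.symm, one_apply_ne hij, add_comm] using this
  have hmul : ∀ i j k, i ≠ j → j ≠ k → i ≠ k → ∀ x y, f i k (x * y) = f i j x * f j k y := by
    intro i j k hij hjk hik x y
    have := congrArg ρ (E_rel_mul hij hjk hik x y)
    rw [map_mul, map_mul, map_mul, hf, hf, hf] at this
    have := congrFun (congrFun this i) k
    simpa [mul_add, add_mul, single_mul_single_of_ne _ _ _ _ hij.symm,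
      single_mul_single_of_ne _ _ _ _ hik.symm,
      single_mul_single_of_ne _ _ _ _ hjk.symm, one_apply_ne hik, one_apply_ne hij, one_apply_ne hjk,
      hij, hjk, hik, hij.symm, hjk.symm, hik.symm] using this.symm
  have hc0 : ∀ i j, i ≠ j → f i j 1 ≠ 0 := by
    intro i j hij h0
    have := hf i j hij 1
    rw [h0, single_zero, add_zero, ← map_one ρ] at this
    exact transvection_ne_one hij one_ne_zero (hρ this)
  have hinv : ∀ i j, i ≠ j → f i j 1 * f j i 1 = 1 := by
    intro i j hij
    obtain ⟨k, hki, hkj⟩ := exists_third hn i j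
    have h1 := hmul k i j hki hij hkj 1 1
    have h2 := hmul k j i hkj hij.symm hki 1 1
    rw [mul_one] at h1 h2
    apply mul_left_cancel₀ (hc0 k i hki)
    rw [mul_one]; nth_rewrite 2 [h2]; rw [h1]; ring
  -- normalized functions
  have hid : ∀ i j, i ≠ j → ∀ x, f i j x = f i j 1 * x := by
    intro i j hij
    obtain ⟨k, hki, hkj⟩ := exists_third hn i j
    have hm : ∀ x y, f i j (x * y) * f i j 1 = f i j x * f i j y := by
      intro x y
      -- f i j (xy) = f i k x * f k j y
      have h1 := hmul i k j hki.symm hkj hij x y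
      have h2 := hmul i k j hki.symm hkj hij x 1
      have h3 := hmul i k j hki.symm hkj hij 1 y
      have h4 := hmul i k j hki.symm hkj hij 1 1
      rw [mul_one] at h2 h4
      rw [one_mul] at h3
      rw [h1, h2, h3, h4]; ring
    have hc := hc0 i j hij
    have h00 : f i j 0 = 0 := by
      have := hadd i j hij 0 0
      rw [add_zero] at this; linarith
    let g : ℝ →+* ℝ :=
      { toFun := fun x => f i j x / f i j 1
        map_one' := div_self hc
        map_mul' := by
          intro x y
          change f i j (x * y) / f i j 1 = f i j x / f i j 1 * (f i j y / f i j 1)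
          rw [div_mul_div_comm, ← hm, mul_div_mul_right _ _ hc]
        map_zero' := by simp [h00]
        map_add' := by
          intro x y
          rw [hadd i j hij, add_div] }
    intro x
    have hg : g = RingHom.id ℝ := Subsingleton.elim _ _
    have : f i j x / f i j 1 = x := by
      have := congrArg (fun h : ℝ →+* ℝ => h x) hg
      exact this
    field_simp at this
    linarith
  let o : Fin n := ⟨0, by omega⟩
  let s : Fin n → ℝ := fun i => if i = o then 1 else f i o 1
  have hs0 : ∀ i, s i ≠ 0 := by
    intro i
    simp only [s]
    split_ifs with h
    · exact one_ne_zero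
    · exact hc0 i o h
  have hs : ∀ i j, i ≠ j → f i j 1 * s j = s i := by
    intro i j hij
    simp only [s]
    split_ifs with h1 h2 h2
    · exact absurd (h2.trans h1.symm) hij
    · rw [h1, mul_one]
    · rw [h2]; exact hinv _ _ (by rw [← h2]; exact hij)
    · have := hmul i j o hij h1 h2 1 1
      rw [mul_one] at this; exact this.symm
  refine ⟨diagonal s, ?_, ?_⟩
  · rw [det_diagonal, isUnit_iff_ne_zero, Finset.prod_ne_zero_iff]
    exact fun i _ => hs0 i
  · apply SL_induction hn
    · intro i j hij x
      rw [hf, SpecialLinearGroup.transvection_coe]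
      ext a b
      rw [mul_diagonal, diagonal_mul]
      simp only [Matrix.add_apply, one_apply, single_apply]
      split_ifs with h1 h2 h2
      · subst h1; exact absurd (h2.1.trans h2.2.symm) hij
      · subst h1; ring
      · rw [← h2.1, ← h2.2, hid i j hij, ← hs i j hij]; ring
      · ring
    · intro A B hA hB
      rw [map_mul, Matrix.mul_assoc, hB, ← Matrix.mul_assoc, hA, Matrix.mul_assoc,
        Matrix.SpecialLinearGroup.coe_mul]

/-- Theorem of Dieudonné -/
lemma dieudonne {n : ℕ} (hn : 3 ≤ n)
    (ψ : Matrix.SpecialLinearGroup (Fin n) ℝ ≃* Matrix.SpecialLinearGroup (Fin n) ℝ) :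
    ∃ T : Matrix (Fin n) (Fin n) ℝ, IsUnit T.det ∧
      ((∀ A, (ψ A : Matrix (Fin n) (Fin n) ℝ) * T = T * (A : Matrix (Fin n) (Fin n) ℝ)) ∨
       (∀ A, (ψ A : Matrix (Fin n) (Fin n) ℝ) * T =
          T * ((A⁻¹ : Matrix.SpecialLinearGroup (Fin n) ℝ) : Matrix (Fin n) (Fin n) ℝ)ᵀ)) := by
  let ρ0 : Matrix.SpecialLinearGroup (Fin n) ℝ →* Matrix (Fin n) (Fin n) ℝ :=
    SpecialLinearGroup.coeMonoidHom.comp ψ.toMonoidHom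
  have hρ0 : Function.Injective ρ0 :=
    SpecialLinearGroup.coeMonoidHom_injective.comp ψ.injective
  obtain ⟨T, hT, hTd⟩ := exists_basis hn ρ0 hρ0
  have hT1 : T * T⁻¹ = 1 := mul_nonsing_inv _ hT
  have hT2 : T⁻¹ * T = 1 := nonsing_inv_mul _ hT
  let ρ : Matrix.SpecialLinearGroup (Fin n) ℝ →* Matrix (Fin n) (Fin n) ℝ :=
    { toFun := fun A => T⁻¹ * ρ0 A * T
      map_one' := by simp [hT2]
      map_mul' := by
        intro A B
        rw [map_mul]
        calc T⁻¹ * (ρ0 A * ρ0 B) * T = T⁻¹ * ρ0 A * 1 * ρ0 B * T := by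
              simp only [Matrix.mul_assoc, Matrix.one_mul]
          _ = _ := by rw [← hT1]; simp only [Matrix.mul_assoc] }
  have hρA : ∀ A, ρ A = T⁻¹ * ρ0 A * T := fun A => rfl
  have hρT : ∀ A, T * ρ A = ρ0 A * T := by
    intro A
    rw [hρA, ← Matrix.mul_assoc, ← Matrix.mul_assoc, hT1, Matrix.one_mul]
  have hρ : Function.Injective ρ := by
    intro A B h
    apply hρ0
    have h1 : ρ0 A * T = ρ0 B * T := by rw [← hρT, ← hρT, h]
    have := congrArg (fun X => X * T⁻¹) h1
    simpa [Matrix.mul_assoc, hT1] using this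
  have hd : ∀ k l, ρ (dS k l) = (dS k l : Matrix (Fin n) (Fin n) ℝ) := by
    intro k l
    rw [hρA, Matrix.mul_assoc, hTd, ← Matrix.mul_assoc, hT2, Matrix.one_mul]
  rcases E_type hn ρ hρ hd with ht | ht
  · obtain ⟨S, hS, hS'⟩ := plus_type hn ρ hρ hd ht
    refine ⟨T * S, by rw [det_mul]; exact hT.mul hS, Or.inl fun A => ?_⟩
    show ρ0 A * (T * S) = _
    rw [← Matrix.mul_assoc, ← hρT, Matrix.mul_assoc, hS', Matrix.mul_assoc]
  · let ρ' : Matrix.SpecialLinearGroup (Fin n) ℝ →* Matrix (Fin n) (Fin n) ℝ :=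
      { toFun := fun A => (ρ A⁻¹)ᵀ
        map_one' := by simp
        map_mul' := by
          intro A B
          rw [_root_.mul_inv_rev, map_mul, transpose_mul] }
    have hρ' : Function.Injective ρ' := by
      intro A B h
      exact inv_injective (hρ (transpose_injective h))
    obtain ⟨S, hS, hS'⟩ := plus_type hn ρ' hρ' (by
      intro k l
      show (ρ (dS k l)⁻¹)ᵀ = _
      rw [inv_eq_of_mul_eq_one_left (dS_sq k l), hd, dS_coe, diagonal_transpose]) (by
      intro i j hij x
      show (ρ (SpecialLinearGroup.transvection hij x)⁻¹)ᵀ j i = 0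
      rw [SpecialLinearGroup.transvection_inv, transpose_apply]
      exact ht i j hij (-x))
    have hSt : IsUnit Sᵀ.det := by rwa [det_transpose]
    refine ⟨T * (Sᵀ)⁻¹, ?_, Or.inr fun A => ?_⟩
    · rw [det_mul]; exact hT.mul (isUnit_nonsing_inv_det _ hSt)
    · have h1 : (ρ A)ᵀ * S = S * ((A⁻¹ : Matrix.SpecialLinearGroup (Fin n) ℝ) : Matrix (Fin n) (Fin n) ℝ) := by
        have := hS' A⁻¹
        change (ρ A⁻¹⁻¹)ᵀ * S = _ at this
        rwa [inv_inv] at this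
      have h2 := congrArg transpose h1
      rw [transpose_mul, transpose_mul, transpose_transpose] at h2
      show ρ0 A * (T * (Sᵀ)⁻¹) = _
      rw [← Matrix.mul_assoc, ← hρT, Matrix.mul_assoc, Matrix.mul_assoc]
      congr 1
      have h3 : (Sᵀ)⁻¹ * (Sᵀ * ρ A) * (Sᵀ)⁻¹ = (Sᵀ)⁻¹ * (((A⁻¹ : Matrix.SpecialLinearGroup (Fin n) ℝ) : Matrix (Fin n) (Fin n) ℝ)ᵀ * Sᵀ) * (Sᵀ)⁻¹ := by
        rw [h2]
      rw [← Matrix.mul_assoc, nonsing_inv_mul _ hSt, Matrix.one_mul] at h3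
      rw [h3, Matrix.mul_assoc, Matrix.mul_assoc, mul_nonsing_inv _ hSt, Matrix.mul_one]

end stage3

section stage4

open Matrix

lemma pow_sum_prod (m : ℕ) :
    ∑ i ∈ Finset.range (m + 2), (2 : ℝ) ^ (i + 1) + 1 ≤ ∏ i ∈ Finset.range (m + 2), (2 : ℝ) ^ (i + 1) := by
  induction m with
  | zero => norm_num [Finset.sum_range_succ, Finset.prod_range_succ]
  | succ m ih =>
    rw [show m + 1 + 2 = (m + 2) + 1 by ring, Finset.sum_range_succ, Finset.prod_range_succ]
    have h1 : (2 : ℝ) ≤ 2 ^ (m + 2 + 1) := by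
      have : (1 : ℝ) ≤ 2 ^ (m + 2) := one_le_pow₀ (by norm_num)
      rw [pow_succ]; linarith
    have h0 : (0 : ℝ) < ∑ i ∈ Finset.range (m + 2), (2 : ℝ) ^ (i + 1) := by
      apply Finset.sum_pos
      · intros; positivity
      · simp
    have h2 : (2 : ℝ) ≤ ∑ i ∈ Finset.range (m + 2), (2 : ℝ) ^ (i + 1) := by
      have := Finset.single_le_sum (f := fun i : ℕ => (2 : ℝ) ^ (i + 1))
        (s := Finset.range (m + 2)) (fun i _ => by positivity) (a := 0) (by simp)
      simpa using this
    nlinarith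

lemma exists_a0 {n : ℕ} (hn : 3 ≤ n) : ∃ a : Fin n → ℝ, Function.Injective a ∧ (∀ i, a i ≠ 0) ∧
    ∏ i, a i = 1 ∧ ∑ i, a i ≠ ∑ i, (a i)⁻¹ := by
  obtain ⟨m, rfl⟩ : ∃ m, n = m + 2 + 1 := ⟨n - 3, by omega⟩
  set P : ℝ := ∏ i ∈ Finset.range (m + 2), (2 : ℝ) ^ (i + 1) with hP
  have hsp := pow_sum_prod m
  rw [← hP] at hsp
  have hP0 : 1 < P := by
    have : (0 : ℝ) < ∑ i ∈ Finset.range (m + 2), (2 : ℝ) ^ (i + 1) := by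
      apply Finset.sum_pos
      · intros; positivity
      · simp
    linarith
  have hPi : P⁻¹ < 1 := inv_lt_one_of_one_lt₀ hP0
  have hPi0 : 0 < P⁻¹ := by positivity
  have hpw : ∀ i : ℕ, (1 : ℝ) ≤ 2 ^ (i + 1) := fun i => one_le_pow₀ (by norm_num)
  refine ⟨Fin.cons P⁻¹ (fun i : Fin (m + 2) => (2 : ℝ) ^ ((i : ℕ) + 1)), ?_, ?_, ?_, ?_⟩
  · rw [Fin.cons_injective_iff]
    constructor
    · rintro ⟨i, hi⟩
      have := hpw i
      simp only at hi
      linarith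
    · intro i j h
      have := pow_right_injective₀ (a := (2 : ℝ)) (by norm_num) (by norm_num) h
      ext; simpa using this
  · intro i
    refine Fin.cases ?_ (fun i => ?_) i
    · simpa using hPi0.ne'
    · simp
  · rw [Fin.prod_univ_succ]
    simp only [Fin.cons_zero, Fin.cons_succ]
    rw [Fin.prod_univ_eq_prod_range (fun i => (2 : ℝ) ^ (i + 1)), ← hP]
    exact inv_mul_cancel₀ (by linarith)
  · rw [Fin.sum_univ_succ (n := m + 2), Fin.sum_univ_succ (n := m + 2) (f := fun i => (_ : ℝ)⁻¹)]
    simp only [Fin.cons_zero, Fin.cons_succ, inv_inv]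
    rw [Fin.sum_univ_eq_sum_range (fun i => (2 : ℝ) ^ (i + 1))]
    have : 0 ≤ ∑ i : Fin (m + 2), ((2 : ℝ) ^ ((i : ℕ) + 1))⁻¹ :=
      Finset.sum_nonneg (fun i _ => by positivity)
    linarith

lemma exists_b0 {n : ℕ} (hn : 3 ≤ n) : ∃ B : Matrix.SpecialLinearGroup (Fin n) ℝ,
    ∀ i j, i ≠ j → B i j ≠ 0 := by
  obtain ⟨m, rfl⟩ : ∃ m, n = m + 1 := ⟨n - 1, by omega⟩
  let v : Fin (m + 1) → ℝ := Fin.cons (-(m : ℝ)) (fun _ => 1)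
  have hv : ∀ i, v i ≠ 0 := by
    intro i
    refine Fin.cases ?_ (fun i => ?_) i
    · simp only [v, Fin.cons_zero, ne_eq, neg_eq_zero, Nat.cast_eq_zero]; omega
    · simp [v]
  have hdet : (1 + vecMulVec (fun _ => (1 : ℝ)) v).det = 1 := by
    rw [vecMulVec_eq Unit, det_one_add_replicateCol_mul_replicateRow]
    simp [dotProduct, Fin.sum_univ_succ, v]
  refine ⟨⟨_, hdet⟩, fun i j hij => ?_⟩
  change (1 + vecMulVec (fun _ => (1 : ℝ)) v) i j ≠ 0
  simp [vecMulVec_apply, one_apply, hij, hv]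

lemma trace_conj_eq {n : ℕ} {X Y T : Matrix (Fin n) (Fin n) ℝ} (hT : IsUnit T.det)
    (h : X * T = T * Y) : X.trace = Y.trace := by
  have : X = T * Y * T⁻¹ := by
    rw [← h, Matrix.mul_assoc, mul_nonsing_inv _ hT, Matrix.mul_one]
  rw [this, trace_mul_cycle, nonsing_inv_mul _ hT, Matrix.one_mul]

lemma diag_mul_single {n : ℕ} (d : Fin n → ℝ) (i j : Fin n) (c : ℝ) :
    diagonal d * single i j c = single i j (d i * c) := by
  ext k l
  rw [diagonal_mul, single_apply, single_apply]
  split_ifs with h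
  · rw [h.1]
  · rw [mul_zero]

lemma single_mul_diag {n : ℕ} (d : Fin n → ℝ) (i j : Fin n) (c : ℝ) :
    single i j c * diagonal d = single i j (c * d j) := by
  ext k l
  rw [mul_diagonal, single_apply, single_apply]
  split_ifs with h
  · rw [h.2]
  · rw [zero_mul]

lemma local_fix {n : ℕ} (hn : 3 ≤ n)
    (φ : Matrix.SpecialLinearGroup (Fin n) ℝ → Matrix.SpecialLinearGroup (Fin n) ℝ)
    (hloc : ∀ A B : Matrix.SpecialLinearGroup (Fin n) ℝ,
      ∃ ψ : Matrix.SpecialLinearGroup (Fin n) ℝ ≃* Matrix.SpecialLinearGroup (Fin n) ℝ,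
        φ A = ψ A ∧ φ B = ψ B)
    (a : Fin n → ℝ) (hinj : Function.Injective a) (h0 : ∀ i, a i ≠ 0)
    (hsum : ∑ i, a i ≠ ∑ i, (a i)⁻¹) (A0 B0 : Matrix.SpecialLinearGroup (Fin n) ℝ)
    (hA0 : (A0 : Matrix (Fin n) (Fin n) ℝ) = diagonal a)
    (hB0 : ∀ i j, i ≠ j → B0 i j ≠ 0) (hfA : φ A0 = A0) (hfB : φ B0 = B0) (Y) : φ Y = Y := by
  have hA0i : ((A0⁻¹ : Matrix.SpecialLinearGroup (Fin n) ℝ) : Matrix (Fin n) (Fin n) ℝ)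
      = diagonal (fun i => (a i)⁻¹) := by
    have h1 : (A0 : Matrix (Fin n) (Fin n) ℝ) *
        ((A0⁻¹ : Matrix.SpecialLinearGroup (Fin n) ℝ) : Matrix (Fin n) (Fin n) ℝ) = 1 := by
      rw [← Matrix.SpecialLinearGroup.coe_mul, mul_inv_cancel, Matrix.SpecialLinearGroup.coe_one]
    have h2 : diagonal (fun i => (a i)⁻¹) * (A0 : Matrix (Fin n) (Fin n) ℝ) = 1 := by
      rw [hA0, diagonal_mul_diagonal, ← diagonal_one]
      congr 1; ext i; exact inv_mul_cancel₀ (h0 i)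
    exact (left_inv_eq_right_inv h2 h1).symm
  have K2 : ∀ X : Matrix.SpecialLinearGroup (Fin n) ℝ,
      (φ X : Matrix (Fin n) (Fin n) ℝ).trace = (X : Matrix (Fin n) (Fin n) ℝ).trace →
      (X : Matrix (Fin n) (Fin n) ℝ).trace ≠
        ((X⁻¹ : Matrix.SpecialLinearGroup (Fin n) ℝ) : Matrix (Fin n) (Fin n) ℝ).trace →
      ∀ Y, ∃ T : Matrix (Fin n) (Fin n) ℝ, IsUnit T.det ∧
        (φ X : Matrix (Fin n) (Fin n) ℝ) * T = T * X ∧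
        (φ Y : Matrix (Fin n) (Fin n) ℝ) * T = T * Y := by
    intro X h1 h2 Y
    obtain ⟨ψ, hX, hY⟩ := hloc X Y
    obtain ⟨T, hT, h | h⟩ := dieudonne hn ψ
    · exact ⟨T, hT, by rw [hX]; exact h X, by rw [hY]; exact h Y⟩
    · exfalso
      have := trace_conj_eq hT (h X)
      rw [trace_transpose, ← hX, h1] at this
      exact h2 this
  have K2t : ∀ X : Matrix.SpecialLinearGroup (Fin n) ℝ,
      (φ X : Matrix (Fin n) (Fin n) ℝ).trace = (X : Matrix (Fin n) (Fin n) ℝ).trace →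
      (X : Matrix (Fin n) (Fin n) ℝ).trace ≠
        ((X⁻¹ : Matrix.SpecialLinearGroup (Fin n) ℝ) : Matrix (Fin n) (Fin n) ℝ).trace →
      ∀ Y, ((φ X : Matrix (Fin n) (Fin n) ℝ) * (φ Y : Matrix (Fin n) (Fin n) ℝ)).trace =
        ((X : Matrix (Fin n) (Fin n) ℝ) * (Y : Matrix (Fin n) (Fin n) ℝ)).trace := by
    intro X h1 h2 Y
    obtain ⟨T, hT, hX, hY⟩ := K2 X h1 h2 Y
    apply trace_conj_eq hT
    rw [Matrix.mul_assoc, hY, ← Matrix.mul_assoc, hX, Matrix.mul_assoc]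
  have hA0t : (A0 : Matrix (Fin n) (Fin n) ℝ).trace ≠
        ((A0⁻¹ : Matrix.SpecialLinearGroup (Fin n) ℝ) : Matrix (Fin n) (Fin n) ℝ).trace := by
    rw [hA0, hA0i, trace_diagonal, trace_diagonal]; exact hsum
  have K3 : ∀ Y, ∃ t : Fin n → ℝ, (∀ i, t i ≠ 0) ∧
      ∀ i j, φ Y i j * t j = t i * Y i j := by
    intro Y
    obtain ⟨T, hT, hX, hY⟩ := K2 A0 (by rw [hfA]) hA0t Y
    rw [hfA, hA0] at hX
    have hoff : ∀ i j, i ≠ j → T i j = 0 := by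
      intro i j hij
      have := congrFun (congrFun hX i) j
      rw [diagonal_mul, mul_diagonal] at this
      have h3 : a i - a j ≠ 0 := sub_ne_zero.mpr (hinj.ne hij)
      have h4 : (a i - a j) * T i j = 0 := by linarith
      exact (mul_eq_zero.mp h4).resolve_left h3
    have hTd : T = diagonal (fun i => T i i) := by
      ext i j
      by_cases hij : i = j
      · subst hij; simp
      · rw [diagonal_apply_ne _ hij, hoff i j hij]
    refine ⟨fun i => T i i, ?_, ?_⟩
    · intro i hi
      rw [hTd, det_diagonal] at hT
      exact hT.ne_zero (Finset.prod_eq_zero (Finset.mem_univ i) hi)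
    · intro i j
      rw [hTd] at hY
      have := congrFun (congrFun hY i) j
      rw [diagonal_mul, mul_diagonal] at this
      exact this
  have K3d : ∀ Y i, φ Y i i = Y i i := by
    intro Y i
    obtain ⟨t, ht, h⟩ := K3 Y
    have := h i i
    rw [mul_comm (t i)] at this
    exact mul_right_cancel₀ (ht i) this
  have K3z : ∀ Y i j, Y i j = 0 → φ Y i j = 0 := by
    intro Y i j hz
    obtain ⟨t, ht, h⟩ := K3 Y
    have := h i j
    rw [hz, mul_zero] at this
    exact (mul_eq_zero.mp this).resolve_right (ht j)
  have K3t : ∀ Y, (φ Y : Matrix (Fin n) (Fin n) ℝ).trace = (Y : Matrix (Fin n) (Fin n) ℝ).trace :=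
    fun Y => Finset.sum_congr rfl (fun i _ => K3d Y i)
  have key : ∀ (i j : Fin n) (hij : i ≠ j), 
      ∃ X : Matrix.SpecialLinearGroup (Fin n) ℝ,
        (X : Matrix (Fin n) (Fin n) ℝ) = A0 + single i j (a i) ∧
        (X : Matrix (Fin n) (Fin n) ℝ).trace ≠
        ((X⁻¹ : Matrix.SpecialLinearGroup (Fin n) ℝ) : Matrix (Fin n) (Fin n) ℝ).trace := by
    intro i j hij
    have e1 : ((A0 * SpecialLinearGroup.transvection hij (1 : ℝ) : Matrix.SpecialLinearGroup (Fin n) ℝ) : Matrix (Fin n) (Fin n) ℝ) = A0 + single i j (a i) := by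
      rw [Matrix.SpecialLinearGroup.coe_mul, SpecialLinearGroup.transvection_coe, hA0, mul_add,
        Matrix.mul_one, diag_mul_single, mul_one]
    have e2 : (((A0 * SpecialLinearGroup.transvection hij (1 : ℝ))⁻¹ : Matrix.SpecialLinearGroup (Fin n) ℝ) : Matrix (Fin n) (Fin n) ℝ) =
        diagonal (fun i => (a i)⁻¹) + single i j (-(a j)⁻¹) := by
      have h1 : ((A0 * SpecialLinearGroup.transvection hij (1 : ℝ) : Matrix.SpecialLinearGroup (Fin n) ℝ) : Matrix (Fin n) (Fin n) ℝ) *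
        (((A0 * SpecialLinearGroup.transvection hij (1 : ℝ))⁻¹ : Matrix.SpecialLinearGroup (Fin n) ℝ) : Matrix (Fin n) (Fin n) ℝ) = 1 := by
        rw [← Matrix.SpecialLinearGroup.coe_mul, mul_inv_cancel, Matrix.SpecialLinearGroup.coe_one]
      refine (left_inv_eq_right_inv ?_ h1).symm
      rw [e1, hA0, mul_add, add_mul, add_mul, diagonal_mul_diagonal, diag_mul_single,
        single_mul_diag, single_mul_single_of_ne _ _ _ _ hij.symm, add_zero, add_assoc, ← single_add]
      have : (fun i => (a i)⁻¹ * a i) = fun _ => 1 := by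
        ext i; exact inv_mul_cancel₀ (h0 i)
      rw [this, diagonal_one, neg_mul, inv_mul_cancel₀ (h0 i), inv_mul_cancel₀ (h0 j)]
      simp
    refine ⟨_, e1, ?_⟩
    rw [e1, e2, trace_add, trace_add, hA0, trace_diagonal, trace_diagonal]
    rw [trace_single_eq_of_ne _ _ _ hij, trace_single_eq_of_ne _ _ _ hij, add_zero, add_zero]
    exact hsum
  have htr : ∀ (i j : Fin n) (c : ℝ) (M : Matrix (Fin n) (Fin n) ℝ),
      (single i j c * M).trace = c * M j i := by
    intro i j c M
    rw [trace_single_mul, smul_eq_mul]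
  have K4 : ∀ (i j : Fin n) (hij : i ≠ j) (X : Matrix.SpecialLinearGroup (Fin n) ℝ),
        (X : Matrix (Fin n) (Fin n) ℝ) = A0 + single i j (a i) → 
        (X : Matrix (Fin n) (Fin n) ℝ).trace ≠
        ((X⁻¹ : Matrix.SpecialLinearGroup (Fin n) ℝ) : Matrix (Fin n) (Fin n) ℝ).trace →
        φ X = X := by
    intro i j hij X hX hne
    have hXd : ∀ k l, X k l = diagonal a k l + single i j (a i) k l := by
      intro k l
      have := congrFun (congrFun hX k) l
      rw [hA0] at this
      exact this
    have h1 : (φ X : Matrix (Fin n) (Fin n) ℝ) = A0 + single i j (φ X i j) := by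
      ext k l
      rw [hA0, Matrix.add_apply]
      by_cases hkl : k = l
      · subst hkl
        have h5 : ¬ (i = k ∧ j = k) := fun h => hij (h.1.trans h.2.symm)
        rw [K3d, hXd, single_apply, single_apply, if_neg h5, if_neg h5]
      · by_cases h6 : i = k ∧ j = l
        · obtain ⟨rfl, rfl⟩ := h6
          rw [diagonal_apply_ne _ hkl, single_apply_same, zero_add]
        · rw [diagonal_apply_ne _ hkl, single_apply, if_neg h6, add_zero]
          apply K3z
          rw [hXd, diagonal_apply_ne _ hkl, single_apply, if_neg h6, add_zero]
    have h2 := K2t X (K3t X) hne B0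
    rw [hfB, h1, hX, add_mul, add_mul, trace_add, trace_add, htr, htr] at h2
    have h3 := mul_right_cancel₀ (hB0 j i hij.symm) (add_left_cancel h2)
    apply Subtype.ext
    change (φ X : Matrix (Fin n) (Fin n) ℝ) = (X : Matrix (Fin n) (Fin n) ℝ)
    rw [h1, hX, h3]
  apply Subtype.ext
  ext j i
  by_cases hij : i = j
  · subst hij; exact K3d Y i
  · obtain ⟨X, hX, hne⟩ := key i j hij
    have h1 := K2t X (K3t X) hne Y
    have h2 := K2t A0 (K3t A0) hA0t Y
    rw [K4 i j hij X hX hne, hX, add_mul, add_mul, trace_add, trace_add, htr, htr] at h1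
    rw [hfA] at h2
    rw [h2] at h1
    exact mul_left_cancel₀ (h0 i) (add_left_cancel h1)

end stage4

/-- Every local automorphism of `SLₙ(ℝ)`, `n ≥ 3`, is an automorphism; moreover it is
either `A ↦ TAT⁻¹` or `A ↦ T(A⁻¹)ᵗT⁻¹` for some `T ∈ GLₙ(ℝ)`. -/
theorem stmt_16 (n : ℕ) (hn : 3 ≤ n)
    (φ : Matrix.SpecialLinearGroup (Fin n) ℝ → Matrix.SpecialLinearGroup (Fin n) ℝ)
    (hloc : ∀ A B : Matrix.SpecialLinearGroup (Fin n) ℝ,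
      ∃ ψ : Matrix.SpecialLinearGroup (Fin n) ℝ ≃* Matrix.SpecialLinearGroup (Fin n) ℝ,
        φ A = ψ A ∧ φ B = ψ B) :
    (∃ Ψ : Matrix.SpecialLinearGroup (Fin n) ℝ ≃* Matrix.SpecialLinearGroup (Fin n) ℝ,
      ∀ A, φ A = Ψ A) ∧
    ∃ T : Matrix (Fin n) (Fin n) ℝ, IsUnit T.det ∧
      ((∀ A : Matrix.SpecialLinearGroup (Fin n) ℝ,
          (φ A : Matrix (Fin n) (Fin n) ℝ) = T * (A : Matrix (Fin n) (Fin n) ℝ) * T⁻¹) ∨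
       (∀ A : Matrix.SpecialLinearGroup (Fin n) ℝ,
          (φ A : Matrix (Fin n) (Fin n) ℝ) =
            T * ((A : Matrix (Fin n) (Fin n) ℝ)⁻¹)ᵀ * T⁻¹)) := by
  obtain ⟨a, hinj, h0, hprod, hsum⟩ := exists_a0 hn
  obtain ⟨B0, hB0⟩ := exists_b0 hn
  let A0 : Matrix.SpecialLinearGroup (Fin n) ℝ :=
    ⟨Matrix.diagonal a, by rw [Matrix.det_diagonal, hprod]⟩
  obtain ⟨ψ, hA, hB⟩ := hloc A0 B0
  have hφ : ∀ A, φ A = ψ A := by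
    intro A
    have := local_fix hn (fun X => ψ.symm (φ X)) (by
      intro X Y
      obtain ⟨χ, h1, h2⟩ := hloc X Y
      exact ⟨χ.trans ψ.symm, by simp [h1], by simp [h2]⟩) a hinj h0 hsum A0 B0 rfl hB0
      (by simp [hA]) (by simp [hB]) A
    exact (MulEquiv.symm_apply_eq ψ).mp this
  refine ⟨⟨ψ, hφ⟩, ?_⟩
  obtain ⟨T, hT, h⟩ := dieudonne hn ψ
  have hc : ∀ X Y : Matrix (Fin n) (Fin n) ℝ, X * T = T * Y → X = T * Y * T⁻¹ := by
    intro X Y h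
    rw [← h, Matrix.mul_assoc, Matrix.mul_nonsing_inv _ hT, Matrix.mul_one]
  refine ⟨T, hT, h.imp (fun h A => ?_) (fun h A => ?_)⟩
  · rw [hφ]; exact hc _ _ (h A)
  · rw [hφ]
    have hi : (A : Matrix (Fin n) (Fin n) ℝ)⁻¹ =
        ((A⁻¹ : Matrix.SpecialLinearGroup (Fin n) ℝ) : Matrix (Fin n) (Fin n) ℝ) := by
      rw [Matrix.SpecialLinearGroup.coe_inv, Matrix.inv_def, A.det_coe]
      simp
    rw [hi]
    exact hc _ _ (h A)
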